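/- arXiv:1506.06308 — 2 statements merged into one kernel-verified Lean document; each statement's English description precedes it below -/
import Mathlib

section
/- For every integer s ≥ 1, every ω > 0 and every t ≥ 0, the exact identity y(t; ω) = p_{0,0}(t) + Σ_{r=1}^{s} ω^{−r} ( p_{r,0}(t) + Σ_{m=1}^{M} p_{r,m}(t) e^{i κ_m ω t} ) + Σ_{m=1}^{M} (−i κ_m ω)^{−s} e^{tA} ∫₀ᵗ (d/dx)^{s} [ e^{−xA} a_m(x) ] e^{i κ_m ω x} dx holds. -/
open MeasureTheory

/-- The oscillatory expansion coefficients `p_{r,m}`, `1 ≤ m ≤ M`, of the linear problem. -/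
noncomputable def pOsc {d M : ℕ} (A : Matrix (Fin d) (Fin d) ℂ) (κ : Fin M → ℝ)
    (a : Fin M → ℝ → Fin d → ℂ) (r : ℕ) (m : Fin M) (t : ℝ) : Fin d → ℂ :=
  (Complex.I * (κ m)) ^ (-(r : ℤ)) •
    ∑ ℓ ∈ Finset.range r, ((-1 : ℂ) ^ ℓ * ((r - 1).choose ℓ : ℂ)) •
      (A ^ (r - 1 - ℓ)).mulVec (iteratedDeriv ℓ (a m) t)

/-- The non-oscillatory expansion coefficients `p_{r,0}` of the linear problem. -/
noncomputable def pNonOsc {d M : ℕ} (A : Matrix (Fin d) (Fin d) ℂ) (κ : Fin M → ℝ)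
    (a : Fin M → ℝ → Fin d → ℂ) (r : ℕ) (t : ℝ) : Fin d → ℂ :=
  - (NormedSpace.exp (t • A)).mulVec
      (∑ m : Fin M, (Complex.I * (κ m)) ^ (-(r : ℤ)) •
        ∑ ℓ ∈ Finset.range r, ((-1 : ℂ) ^ ℓ * ((r - 1).choose ℓ : ℂ)) •
          (A ^ (r - 1 - ℓ)).mulVec (iteratedDeriv ℓ (a m) 0))

section MatrixExponential

open Matrix

variable {d : ℕ}

theorem hasDerivAt_mulVec {E : ℝ → Matrix (Fin d) (Fin d) ℂ} {E' : Matrix (Fin d) (Fin d) ℂ}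
    {v : ℝ → Fin d → ℂ} {v' : Fin d → ℂ} {x : ℝ}
    (hE : ∀ i j, HasDerivAt (fun u => E u i j) (E' i j) x) (hv : HasDerivAt v v' x) :
    HasDerivAt (fun u => E u *ᵥ v u) (E' *ᵥ v x + E x *ᵥ v') x := by
  rw [hasDerivAt_pi] at hv ⊢
  intro i
  simp only [Matrix.mulVec, dotProduct, Pi.add_apply, ← Finset.sum_add_distrib]
  exact HasDerivAt.fun_sum fun j _ => (hE i j).mul (hv j)

theorem HasDerivAt.const_mulVec (B : Matrix (Fin d) (Fin d) ℂ) {v : ℝ → Fin d → ℂ}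
    {v' : Fin d → ℂ} {x : ℝ} (hv : HasDerivAt v v' x) :
    HasDerivAt (fun u => B *ᵥ v u) (B *ᵥ v') x := by
  simpa using hasDerivAt_mulVec (E := fun _ => B) (E' := 0)
    (fun i j => by simpa using hasDerivAt_const x (B i j)) hv

section
attribute [local instance] Matrix.linftyOpNormedRing Matrix.linftyOpNormedAlgebra

theorem hasDerivAt_exp_neg_smul_apply (A : Matrix (Fin d) (Fin d) ℂ) (x : ℝ) (i j : Fin d) :
    HasDerivAt (fun u : ℝ => NormedSpace.exp (-(u • A)) i j)
      ((-(NormedSpace.exp (-(x • A)) * A)) i j) x := by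
  have h := hasDerivAt_exp_smul_const (𝕂 := ℝ) (-A) x
  simp only [smul_neg, mul_neg] at h
  exact ((Matrix.entryLinearMap ℝ ℂ i j).toContinuousLinearMap.hasFDerivAt).comp_hasDerivAt x h

end

theorem hasDerivAt_exp_neg_smul_mulVec (A : Matrix (Fin d) (Fin d) ℂ) {b : ℝ → Fin d → ℂ}
    {b' : Fin d → ℂ} {x : ℝ} (hb : HasDerivAt b b' x) :
    HasDerivAt (fun u : ℝ => NormedSpace.exp (-(u • A)) *ᵥ b u)
      (NormedSpace.exp (-(x • A)) *ᵥ (b' - A *ᵥ b x)) x := by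
  convert hasDerivAt_mulVec (hasDerivAt_exp_neg_smul_apply A x) hb using 1
  rw [Matrix.mulVec_sub, Matrix.mulVec_mulVec, Matrix.neg_mulVec]
  abel

theorem exp_smul_mulVec_exp_neg_smul_mulVec (A : Matrix (Fin d) (Fin d) ℂ) (t : ℝ)
    (v : Fin d → ℂ) :
    NormedSpace.exp (t • A) *ᵥ (NormedSpace.exp (-(t • A)) *ᵥ v) = v := by
  rw [Matrix.mulVec_mulVec, ← Matrix.exp_add_of_commute _ _ (Commute.refl (t • A)).neg_right,
    add_neg_cancel, NormedSpace.exp_zero, Matrix.one_mulVec]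

/-- The binomial expansion of `(A - d/du)ⁿ b`. -/
noncomputable def binomDeriv (A : Matrix (Fin d) (Fin d) ℂ) (b : ℝ → Fin d → ℂ) (n : ℕ) (u : ℝ) :
    Fin d → ℂ :=
  ∑ ℓ ∈ Finset.range (n + 1), ((-1 : ℂ) ^ ℓ * (n.choose ℓ : ℂ)) •
    (A ^ (n - ℓ)).mulVec (iteratedDeriv ℓ b u)

theorem hasDerivAt_iteratedDeriv {b : ℝ → Fin d → ℂ} (hb : ∀ n : ℕ, ContDiff ℝ (n : ℕ∞) b)
    (n : ℕ) (x : ℝ) : HasDerivAt (iteratedDeriv n b) (iteratedDeriv (n + 1) b x) x := by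
  rw [iteratedDeriv_succ]
  refine DifferentiableAt.hasDerivAt ?_
  exact ((hb (n + 1)).differentiable_iteratedDeriv n (by norm_cast; simp)) x

theorem hasDerivAt_binomDeriv (A : Matrix (Fin d) (Fin d) ℂ) {b : ℝ → Fin d → ℂ}
    (hb : ∀ n : ℕ, ContDiff ℝ (n : ℕ∞) b) (n : ℕ) (x : ℝ) :
    HasDerivAt (binomDeriv A b n) (A *ᵥ binomDeriv A b n x - binomDeriv A b (n + 1) x) x := by
  have h : HasDerivAt (binomDeriv A b n)
      (∑ ℓ ∈ Finset.range (n + 1), ((-1 : ℂ) ^ ℓ * (n.choose ℓ : ℂ)) •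
        (A ^ (n - ℓ)).mulVec (iteratedDeriv (ℓ + 1) b x)) x :=
    HasDerivAt.fun_sum fun ℓ _ =>
      ((hasDerivAt_iteratedDeriv hb ℓ x).const_mulVec (A ^ (n - ℓ))).fun_const_smul
        ((-1 : ℂ) ^ ℓ * (n.choose ℓ : ℂ))
  convert h using 1
  have hA : A *ᵥ binomDeriv A b n x =
      ∑ ℓ ∈ Finset.range (n + 2), ((-1 : ℂ) ^ ℓ * (n.choose ℓ : ℂ)) •
        (A ^ (n + 1 - ℓ)).mulVec (iteratedDeriv ℓ b x) := by
    rw [Finset.sum_range_succ, Nat.choose_succ_self, binomDeriv, Matrix.mulVec_sum]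
    simp only [Nat.cast_zero, mul_zero, zero_smul, add_zero]
    refine Finset.sum_congr rfl fun ℓ hℓ => ?_
    have : n + 1 - ℓ = n - ℓ + 1 := by have := Finset.mem_range.mp hℓ; omega
    rw [Matrix.mulVec_smul, Matrix.mulVec_mulVec, this, pow_succ']
  rw [hA, binomDeriv, Finset.sum_range_succ', Finset.sum_range_succ' _ (n + 1)]
  simp only [Nat.choose_zero_right, add_sub_add_right_eq_sub, ← Finset.sum_sub_distrib]
  refine Finset.sum_congr rfl fun ℓ _ => ?_
  rw [Nat.add_sub_add_right, ← sub_smul, Nat.choose_succ_succ]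
  congr 1
  push_cast
  ring

theorem iteratedDeriv_exp_neg_smul_mulVec (A : Matrix (Fin d) (Fin d) ℂ) {b : ℝ → Fin d → ℂ}
    (hb : ∀ n : ℕ, ContDiff ℝ (n : ℕ∞) b) (n : ℕ) :
    iteratedDeriv n (fun u : ℝ => NormedSpace.exp (-(u • A)) *ᵥ b u) =
      fun u : ℝ => (-1 : ℂ) ^ n • (NormedSpace.exp (-(u • A)) *ᵥ binomDeriv A b n u) := by
  induction n with
  | zero => ext; simp [binomDeriv]
  | succ n ih =>
    rw [iteratedDeriv_succ, ih]
    funext x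
    refine (((hasDerivAt_exp_neg_smul_mulVec A
      (hasDerivAt_binomDeriv A hb n x)).const_smul ((-1 : ℂ) ^ n)).deriv).trans ?_
    rw [sub_sub_cancel_left, Matrix.mulVec_neg, smul_neg, pow_succ, mul_neg_one, neg_smul]

theorem hasDerivAt_iteratedDeriv_exp_neg_smul_mulVec (A : Matrix (Fin d) (Fin d) ℂ)
    {b : ℝ → Fin d → ℂ} (hb : ∀ n : ℕ, ContDiff ℝ (n : ℕ∞) b) (n : ℕ) (x : ℝ) :
    HasDerivAt (iteratedDeriv n (fun u : ℝ => NormedSpace.exp (-(u • A)) *ᵥ b u))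
      (iteratedDeriv (n + 1) (fun u : ℝ => NormedSpace.exp (-(u • A)) *ᵥ b u) x) x := by
  rw [iteratedDeriv_succ]
  refine DifferentiableAt.hasDerivAt ?_
  rw [iteratedDeriv_exp_neg_smul_mulVec A hb]
  exact ((hasDerivAt_exp_neg_smul_mulVec A
    (hasDerivAt_binomDeriv A hb n x)).const_smul ((-1 : ℂ) ^ n)).differentiableAt

end MatrixExponential

theorem hasDerivAt_cexp_mul_ofReal (c : ℂ) (x : ℝ) :
    HasDerivAt (fun u : ℝ => Complex.exp (c * u)) (c * Complex.exp (c * x)) x := by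
  have h : HasDerivAt (fun u : ℝ => c * (u : ℂ)) c x := by
    simpa using (Complex.ofRealCLM.hasDerivAt (x := x)).const_mul c
  simpa [mul_comm] using h.cexp

/-- Repeated integration by parts against a complex exponential. -/
theorem integral_cexp_smul_eq_sum_add {V : Type*} [NormedAddCommGroup V] [NormedSpace ℝ V]
    [NormedSpace ℂ V] [IsScalarTower ℝ ℂ V] [CompleteSpace V] {c : ℂ} (hc : c ≠ 0)
    {g : ℕ → ℝ → V} (hg : ∀ n x, HasDerivAt (g n) (g (n + 1) x) x) (t : ℝ) (s : ℕ) :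
    ∫ x in (0 : ℝ)..t, Complex.exp (c * x) • g 0 x =
      (∑ n ∈ Finset.range s, ((-1) ^ n * (c ^ (n + 1))⁻¹) •
        (Complex.exp (c * t) • g n t - g n 0)) +
      ((-c) ^ s)⁻¹ • ∫ x in (0 : ℝ)..t, Complex.exp (c * x) • g s x := by
  have hcont : ∀ n, Continuous (g n) := fun n =>
    continuous_iff_continuousAt.mpr fun x => (hg n x).continuousAt
  induction s with
  | zero => simp
  | succ s ih =>
    rw [ih, Finset.sum_range_succ, add_assoc]
    congr 1
    have hparts := intervalIntegral.integral_smul_deriv_eq_deriv_smul (a := 0) (b := t)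
      (fun x _ => hasDerivAt_cexp_mul_ofReal c x) (fun x _ => hg s x)
      (Continuous.intervalIntegrable (by fun_prop) _ _)
      ((hcont (s + 1)).intervalIntegrable _ _)
    simp only [mul_smul, intervalIntegral.integral_smul, Complex.ofReal_zero, mul_zero,
      Complex.exp_zero, one_smul] at hparts
    rw [hparts]
    generalize (∫ x in (0 : ℝ)..t, Complex.exp (c * x) • g s x) = J
    have h1 : (-1 : ℂ) ^ s * (c ^ (s + 1))⁻¹ = -((-c) ^ (s + 1))⁻¹ := by
      rw [neg_pow c, mul_inv, ← inv_pow (-1 : ℂ), inv_neg_one, pow_succ (-1 : ℂ)]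
      ring
    have h2 : ((-c) ^ s)⁻¹ = -(((-c) ^ (s + 1))⁻¹ * c) := by
      rw [pow_succ, mul_inv, mul_assoc, inv_neg, neg_mul, inv_mul_cancel₀ hc, mul_neg_one, neg_neg]
    rw [h1, h2]
    module

/-- Duhamel's formula for a forced linear system. -/
theorem eq_exp_smul_mulVec_add_integral {d : ℕ} (A : Matrix (Fin d) (Fin d) ℂ)
    {y f : ℝ → Fin d → ℂ} (hf : Continuous f) {t : ℝ} (ht : 0 ≤ t)
    (hy : ∀ x, 0 ≤ x → HasDerivAt y (A.mulVec (y x) + f x) x) :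
    y t = (NormedSpace.exp (t • A)).mulVec
      (y 0 + ∫ x in (0 : ℝ)..t, (NormedSpace.exp (-(x • A))).mulVec (f x)) := by
  have hexp : ∀ i j, Continuous fun x : ℝ => NormedSpace.exp (-(x • A)) i j := fun i j =>
    continuous_iff_continuousAt.mpr fun x => (hasDerivAt_exp_neg_smul_apply A x i j).continuousAt
  have hcont : Continuous fun x : ℝ => (NormedSpace.exp (-(x • A))).mulVec (f x) :=
    Continuous.matrix_mulVec (continuous_matrix hexp) hf
  have hint := intervalIntegral.integral_eq_sub_of_hasDerivAt (a := 0) (b := t)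
    (f := fun x : ℝ => (NormedSpace.exp (-(x • A))).mulVec (y x))
    (f' := fun x : ℝ => (NormedSpace.exp (-(x • A))).mulVec (f x))
    (fun x hx => by
      rw [Set.uIcc_of_le ht] at hx
      simpa using hasDerivAt_exp_neg_smul_mulVec A (hy x hx.1))
    (hcont.intervalIntegrable _ _)
  rw [hint, zero_smul, neg_zero, NormedSpace.exp_zero, Matrix.one_mulVec, add_sub_cancel,
    exp_smul_mulVec_exp_neg_smul_mulVec]

/-- Exact remainder form of the asymptotic expansion of the solution of the linear
highly oscillatory ODE. -/
theorem linear_expansion_exact_remainder {d M : ℕ} (hd : 1 ≤ d) (hM : 1 ≤ M)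
    (A : Matrix (Fin d) (Fin d) ℂ)
    (κ : Fin M → ℝ) (hκ : ∀ m, κ m ≠ 0)
    (a : Fin M → ℝ → Fin d → ℂ) (ha : ∀ m, ∀ n : ℕ, ContDiff ℝ (n : ℕ∞) (a m))
    (y₀ : Fin d → ℂ) (ω : ℝ) (hω : 0 < ω)
    (y : ℝ → Fin d → ℂ) (hy0 : y 0 = y₀)
    (hy : ∀ t : ℝ, 0 ≤ t →
      HasDerivAt y
        (A.mulVec (y t) +
          ∑ m : Fin M, Complex.exp (Complex.I * (κ m) * ω * t) • a m t) t)
    (s : ℕ) (hs : 1 ≤ s) (t : ℝ) (ht : 0 ≤ t) :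
    y t =
      (NormedSpace.exp (t • A)).mulVec y₀ +
      (∑ r ∈ Finset.Icc 1 s, ((ω ^ (-(r : ℤ)) : ℝ) : ℂ) •
        (pNonOsc A κ a r t +
          ∑ m : Fin M, Complex.exp (Complex.I * (κ m) * ω * t) • pOsc A κ a r m t)) +
      ∑ m : Fin M, (-(Complex.I * (κ m) * ω)) ^ (-(s : ℤ)) •
        (NormedSpace.exp (t • A)).mulVec
          (∫ x in (0:ℝ)..t, Complex.exp (Complex.I * (κ m) * ω * x) •
            iteratedDeriv s (fun u : ℝ => (NormedSpace.exp (-(u • A))).mulVec (a m u)) x) := by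
  have hc : ∀ m, Complex.I * (κ m) * ω ≠ 0 := fun m => by
    simp [hκ m, hω.ne']
  have hacont : ∀ m, Continuous (a m) := fun m => (ha m 0).continuous
  have hforce : Continuous fun x : ℝ =>
      ∑ m : Fin M, Complex.exp (Complex.I * (κ m) * ω * x) • a m x := by
    fun_prop
  have hIcc : ∀ F : ℕ → Fin d → ℂ,
      ∑ r ∈ Finset.Icc 1 s, F r = ∑ n ∈ Finset.range s, F (n + 1) := fun F => by
    rw [Finset.range_eq_Ico, Finset.sum_Ico_add' F 0 s 1]
    rfl
  have hosc : ∀ n m, pOsc A κ a (n + 1) m t =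
      ((Complex.I * (κ m)) ^ (n + 1))⁻¹ • binomDeriv A (a m) n t := fun n m => by
    rw [pOsc, zpow_neg, zpow_natCast, binomDeriv, Nat.add_sub_cancel]
  have hnon : ∀ n, pNonOsc A κ a (n + 1) t = -∑ m : Fin M, ((Complex.I * (κ m)) ^ (n + 1))⁻¹ •
      (NormedSpace.exp (t • A)).mulVec (binomDeriv A (a m) n 0) := fun n => by
    simp only [pNonOsc, zpow_neg, zpow_natCast, binomDeriv, Nat.add_sub_cancel,
      Matrix.mulVec_sum, Matrix.mulVec_smul]
  have hsplit : (∫ x in (0 : ℝ)..t, (NormedSpace.exp (-(x • A))).mulVec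
        (∑ m : Fin M, Complex.exp (Complex.I * (κ m) * ω * x) • a m x)) =
      ∑ m : Fin M, ∫ x in (0 : ℝ)..t, Complex.exp (Complex.I * (κ m) * ω * x) •
        iteratedDeriv 0 (fun u : ℝ => (NormedSpace.exp (-(u • A))).mulVec (a m u)) x := by
    rw [← intervalIntegral.integral_finsetSum]
    · simp only [Matrix.mulVec_sum, Matrix.mulVec_smul, iteratedDeriv_zero]
    · intro m _
      have hg : Continuous
          (iteratedDeriv 0 (fun u : ℝ => (NormedSpace.exp (-(u • A))).mulVec (a m u))) :=
        continuous_iff_continuousAt.mpr fun x =>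
          (hasDerivAt_iteratedDeriv_exp_neg_smul_mulVec A (ha m) 0 x).continuousAt
      exact Continuous.intervalIntegrable (by fun_prop) _ _
  rw [eq_exp_smul_mulVec_add_integral A hforce ht hy, hy0, hsplit, Matrix.mulVec_add,
    Matrix.mulVec_sum, add_assoc]
  congr 1
  have hterm : ∀ m, (NormedSpace.exp (t • A)).mulVec
      (∫ x in (0 : ℝ)..t, Complex.exp (Complex.I * (κ m) * ω * x) •
        iteratedDeriv 0 (fun u : ℝ => (NormedSpace.exp (-(u • A))).mulVec (a m u)) x) =
      (∑ n ∈ Finset.range s, ((Complex.I * (κ m) * ω) ^ (n + 1))⁻¹ •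
        (Complex.exp (Complex.I * (κ m) * ω * t) • binomDeriv A (a m) n t -
          (NormedSpace.exp (t • A)).mulVec (binomDeriv A (a m) n 0))) +
      (-(Complex.I * (κ m) * ω)) ^ (-(s : ℤ)) • (NormedSpace.exp (t • A)).mulVec
        (∫ x in (0 : ℝ)..t, Complex.exp (Complex.I * (κ m) * ω * x) •
          iteratedDeriv s (fun u : ℝ => (NormedSpace.exp (-(u • A))).mulVec (a m u)) x) := by
    intro m
    rw [integral_cexp_smul_eq_sum_add (hc m)
      (g := fun n => iteratedDeriv n
        (fun u : ℝ => (NormedSpace.exp (-(u • A))).mulVec (a m u)))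
      (hasDerivAt_iteratedDeriv_exp_neg_smul_mulVec A (ha m)) t s,
      Matrix.mulVec_add, Matrix.mulVec_sum, Matrix.mulVec_smul, zpow_neg, zpow_natCast]
    congr 1
    refine Finset.sum_congr rfl fun n _ => ?_
    have hsign : (-1 : ℂ) ^ n * (-1) ^ n = 1 := by rw [← mul_pow]; simp
    simp only [iteratedDeriv_exp_neg_smul_mulVec A (ha m), Matrix.mulVec_smul, Matrix.mulVec_sub,
      exp_smul_mulVec_exp_neg_smul_mulVec, zero_smul, neg_zero, NormedSpace.exp_zero,
      Matrix.one_mulVec]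
    rw [smul_comm (Complex.exp _), ← smul_sub, smul_smul, mul_right_comm, hsign, one_mul]
  rw [Finset.sum_congr rfl fun m _ => hterm m, Finset.sum_add_distrib, Finset.sum_comm, hIcc]
  congr 1
  refine Finset.sum_congr rfl fun n _ => ?_
  rw [hnon, neg_add_eq_sub, ← Finset.sum_sub_distrib, Finset.smul_sum]
  refine Finset.sum_congr rfl fun m _ => ?_
  rw [hosc, mul_pow, mul_inv, zpow_neg, zpow_natCast]
  push_cast
  module
end

section
/- For every T > 0 and every integer s ≥ 0 there exists a constant C > 0 such that for all ω ≥ 1 and all t ∈ [0, T], ‖ y(t; ω) − Y_s(t; ω) ‖ ≤ C ω^{−s−1}; that is, the truncation of the asymptotic expansion at level s approximates the solution of the linear highly oscillatory ODE with uniform error O(ω^{−s−1}). -/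
open MeasureTheory

/-- The truncated asymptotic expansion `Y_s(t; ω)` of the linear problem. -/
noncomputable def truncExp {d M : ℕ} (A : Matrix (Fin d) (Fin d) ℂ) (κ : Fin M → ℝ)
    (a : Fin M → ℝ → Fin d → ℂ) (y₀ : Fin d → ℂ) (s : ℕ) (ω t : ℝ) : Fin d → ℂ :=
  (NormedSpace.exp (t • A)).mulVec y₀ +
    ∑ r ∈ Finset.Icc 1 s, ((ω ^ (-(r : ℤ)) : ℝ) : ℂ) •
      (pNonOsc A κ a r t +
        ∑ m : Fin M, Complex.exp (Complex.I * (κ m) * ω * t) • pOsc A κ a r m t)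

section ExpDerivative

attribute [local instance] Matrix.linftyOpNormedRing Matrix.linftyOpNormedAlgebra

theorem hasDerivAt_exp_smul_mulVec {d : ℕ} (A : Matrix (Fin d) (Fin d) ℂ) (v : Fin d → ℂ)
    (t : ℝ) :
    HasDerivAt (fun t : ℝ => (NormedSpace.exp (t • A)).mulVec v)
      (A.mulVec ((NormedSpace.exp (t • A)).mulVec v)) t := by
  have h := hasDerivAt_exp_smul_const' (𝕂 := ℝ) A t
  let L : Matrix (Fin d) (Fin d) ℂ →ₗ[ℝ] (Fin d → ℂ) :=
    { toFun := fun B => B.mulVec v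
      map_add' := fun B C => Matrix.add_mulVec B C v
      map_smul' := fun c B => Matrix.smul_mulVec c B v }
  have hL := (L.toContinuousLinearMap.hasFDerivAt
    (x := NormedSpace.exp (t • A))).comp_hasDerivAt t h
  rw [Matrix.mulVec_mulVec]
  exact hL

end ExpDerivative

theorem HasDerivAt.matrix_mulVec {d : ℕ} (A : Matrix (Fin d) (Fin d) ℂ)
    {f : ℝ → Fin d → ℂ} {f' : Fin d → ℂ} {t : ℝ} (hf : HasDerivAt f f' t) :
    HasDerivAt (fun t => A.mulVec (f t)) (A.mulVec f') t :=
  ((A.mulVecLin.restrictScalars ℝ).toContinuousLinearMap.hasFDerivAt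
    (x := f t)).comp_hasDerivAt t hf

/-- Pascal's rule for alternating binomial sums. -/
theorem sum_neg_one_pow_choose_succ_smul {E : Type*} [AddCommGroup E] [Module ℂ E]
    (f : ℕ → ℕ → E) (k : ℕ) :
    ∑ ℓ ∈ Finset.range (k + 2), ((-1 : ℂ) ^ ℓ * ((k + 1).choose ℓ : ℂ)) • f (k + 1 - ℓ) ℓ =
      ∑ ℓ ∈ Finset.range (k + 1), ((-1 : ℂ) ^ ℓ * (k.choose ℓ : ℂ)) • f (k + 1 - ℓ) ℓ -
        ∑ ℓ ∈ Finset.range (k + 1), ((-1 : ℂ) ^ ℓ * (k.choose ℓ : ℂ)) • f (k - ℓ) (ℓ + 1) := by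
  have h : ∑ ℓ ∈ Finset.range (k + 1), ((-1 : ℂ) ^ ℓ * (k.choose ℓ : ℂ)) • f (k + 1 - ℓ) ℓ =
      ∑ ℓ ∈ Finset.range (k + 2), ((-1 : ℂ) ^ ℓ * (k.choose ℓ : ℂ)) • f (k + 1 - ℓ) ℓ := by
    rw [Finset.sum_range_succ _ (k + 1)]
    simp
  rw [h, Finset.sum_range_succ' _ (k + 1), Finset.sum_range_succ' _ (k + 1), add_sub_right_comm,
    ← Finset.sum_sub_distrib]
  congr 1
  · refine Finset.sum_congr rfl fun ℓ _ => ?_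
    rw [Nat.add_sub_add_right, ← sub_smul, Nat.choose_succ_succ]
    congr 1
    push_cast
    ring
  · simp

section Coefficients

variable {d M : ℕ} (A : Matrix (Fin d) (Fin d) ℂ) (κ : Fin M → ℝ) (a : Fin M → ℝ → Fin d → ℂ)

theorem smul_pOsc_one {m : Fin M} (hκ : κ m ≠ 0) (t : ℝ) :
    (Complex.I * (κ m)) • pOsc A κ a 1 m t = a m t := by
  have h : Complex.I * (κ m) ≠ 0 := by simp [hκ]
  simp only [pOsc, smul_smul, Nat.cast_one, zpow_neg_one, mul_inv_cancel₀ h]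
  simp

/-- The recursion `iκ p_{r+1} = A p_r - p_r'`, solved for the derivative. -/
theorem hasDerivAt_pOsc {m : Fin M} (hκ : κ m ≠ 0)
    (ha : ∀ n : ℕ, ContDiff ℝ (n : ℕ∞) (a m)) (k : ℕ) (t : ℝ) :
    HasDerivAt (pOsc A κ a (k + 1) m)
      (A.mulVec (pOsc A κ a (k + 1) m t) - (Complex.I * (κ m)) • pOsc A κ a (k + 2) m t) t := by
  have h : Complex.I * (κ m) ≠ 0 := by simp [hκ]
  have hder : ∀ ℓ : ℕ, HasDerivAt (iteratedDeriv ℓ (a m)) (iteratedDeriv (ℓ + 1) (a m) t) t := by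
    intro ℓ
    rw [iteratedDeriv_succ]
    refine ((ha (ℓ + 1)).differentiable_iteratedDeriv ℓ ?_ t).hasDerivAt
    exact_mod_cast Nat.lt_succ_self ℓ
  have hsum := (HasDerivAt.fun_sum (u := Finset.range (k + 1)) fun ℓ _ =>
    ((hder ℓ).matrix_mulVec (A ^ (k - ℓ))).const_smul
      ((-1 : ℂ) ^ ℓ * (k.choose ℓ : ℂ))).const_smul ((Complex.I * (κ m)) ^ (-((k + 1 : ℕ) : ℤ)))
  refine hsum.congr_deriv ?_
  have hp := sum_neg_one_pow_choose_succ_smul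
    (fun i j => (A ^ i).mulVec (iteratedDeriv j (a m) t)) k
  have hA : ∑ ℓ ∈ Finset.range (k + 1), ((-1 : ℂ) ^ ℓ * (k.choose ℓ : ℂ)) •
        (A ^ (k + 1 - ℓ)).mulVec (iteratedDeriv ℓ (a m) t) =
      A.mulVec (∑ ℓ ∈ Finset.range (k + 1), ((-1 : ℂ) ^ ℓ * (k.choose ℓ : ℂ)) •
        (A ^ (k - ℓ)).mulVec (iteratedDeriv ℓ (a m) t)) := by
    rw [Matrix.mulVec_sum]
    refine Finset.sum_congr rfl fun ℓ hℓ => ?_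
    have hℓ' : k + 1 - ℓ = (k - ℓ) + 1 := by
      have := Finset.mem_range.mp hℓ
      omega
    rw [Matrix.mulVec_smul, Matrix.mulVec_mulVec, hℓ', pow_succ']
  have hz : Complex.I * (κ m) * (Complex.I * (κ m)) ^ (-((k + 2 : ℕ) : ℤ)) =
      (Complex.I * (κ m)) ^ (-((k + 1 : ℕ) : ℤ)) := by
    rw [← zpow_one_add₀ h]
    congr 1
  simp only [pOsc, Nat.add_sub_cancel, show k + 2 - 1 = k + 1 from rfl]
  rw [smul_smul, hz, Matrix.mulVec_smul, ← smul_sub, hp, hA]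
  simp

theorem continuous_pOsc {m : Fin M} (ha : ∀ n : ℕ, ContDiff ℝ (n : ℕ∞) (a m)) (r : ℕ) :
    Continuous (pOsc A κ a r m) := by
  unfold pOsc
  have h : ∀ ℓ : ℕ, Continuous (iteratedDeriv ℓ (a m)) := fun ℓ =>
    (ha ℓ).continuous_iteratedDeriv ℓ le_rfl
  refine Continuous.fun_const_smul (continuous_finsetSum _ fun ℓ _ => ?_) _
  exact (continuous_const.matrix_mulVec (h ℓ)).fun_const_smul _

theorem hasDerivAt_pNonOsc (r : ℕ) (t : ℝ) :
    HasDerivAt (pNonOsc A κ a r) (A.mulVec (pNonOsc A κ a r t)) t := by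
  unfold pNonOsc
  rw [Matrix.mulVec_neg]
  exact (hasDerivAt_exp_smul_mulVec A _ t).fun_neg

theorem pNonOsc_zero_add_sum_pOsc (r : ℕ) :
    pNonOsc A κ a r 0 + ∑ m : Fin M, pOsc A κ a r m 0 = 0 := by
  simp [pNonOsc, pOsc]

theorem truncExp_succ (y₀ : Fin d → ℂ) (s : ℕ) (ω t : ℝ) :
    truncExp A κ a y₀ (s + 1) ω t = truncExp A κ a y₀ s ω t +
      ((ω ^ (-((s + 1 : ℕ) : ℤ)) : ℝ) : ℂ) • (pNonOsc A κ a (s + 1) t +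
        ∑ m : Fin M, Complex.exp (Complex.I * (κ m) * ω * t) • pOsc A κ a (s + 1) m t) := by
  rw [truncExp, truncExp, Finset.sum_Icc_succ_top (Nat.le_add_left 1 s), add_assoc]

theorem truncExp_apply_zero (y₀ : Fin d → ℂ) (s : ℕ) (ω : ℝ) :
    truncExp A κ a y₀ s ω 0 = y₀ := by
  simp [truncExp, pNonOsc_zero_add_sum_pOsc]

theorem hasDerivAt_cexp_I_mul (c ω t : ℝ) :
    HasDerivAt (fun t : ℝ => Complex.exp (Complex.I * c * ω * t))
      (Complex.exp (Complex.I * c * ω * t) * (Complex.I * c * ω)) t := by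
  have h : HasDerivAt (fun t : ℝ => Complex.I * c * ω * (t : ℂ)) (Complex.I * c * ω) t := by
    simpa using (Complex.ofRealCLM.hasDerivAt (x := t)).const_mul (Complex.I * c * ω)
  exact h.cexp

theorem norm_cexp_I_mul (c ω t : ℝ) : ‖Complex.exp (Complex.I * c * ω * t)‖ = 1 := by
  have h : Complex.I * c * ω * t = ((c * ω * t : ℝ) : ℂ) * Complex.I := by
    push_cast
    ring
  rw [h, Complex.norm_exp_ofReal_mul_I]

/-- The truncated expansion solves the differential equation up to a residual of order
`ω ^ (-s)`. -/
theorem hasDerivAt_truncExp (hκ : ∀ m, κ m ≠ 0) (ha : ∀ m, ∀ n : ℕ, ContDiff ℝ (n : ℕ∞) (a m))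
    (y₀ : Fin d → ℂ) (s : ℕ) {ω : ℝ} (hω : ω ≠ 0) (t : ℝ) :
    HasDerivAt (truncExp A κ a y₀ s ω)
      (A.mulVec (truncExp A κ a y₀ s ω t) +
        ∑ m : Fin M, Complex.exp (Complex.I * (κ m) * ω * t) • a m t -
        ((ω ^ (-(s : ℤ)) : ℝ) : ℂ) • ∑ m : Fin M, Complex.exp (Complex.I * (κ m) * ω * t) •
          (Complex.I * (κ m)) • pOsc A κ a (s + 1) m t) t := by
  induction s with
  | zero =>
    have h : truncExp A κ a y₀ 0 ω = fun t : ℝ => (NormedSpace.exp (t • A)).mulVec y₀ := by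
      funext t
      simp [truncExp]
    rw [h]
    refine (hasDerivAt_exp_smul_mulVec A y₀ t).congr_deriv ?_
    simp [smul_pOsc_one A κ a (hκ _)]
  | succ s ih =>
    have hosc := HasDerivAt.fun_sum (u := Finset.univ) fun (m : Fin M) _ =>
      (hasDerivAt_cexp_I_mul (κ m) ω t).fun_smul (hasDerivAt_pOsc A κ a (hκ m) (ha m) s t)
    have hstep := ih.fun_add (((hasDerivAt_pNonOsc A κ a (s + 1) t).fun_add hosc).const_smul
      ((ω ^ (-((s + 1 : ℕ) : ℤ)) : ℝ) : ℂ))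
    refine (hstep.congr_of_eventuallyEq (.of_forall fun t => truncExp_succ A κ a y₀ s ω t)
      ).congr_deriv ?_
    have hpow : ((ω ^ (-(s : ℤ)) : ℝ) : ℂ) = ((ω ^ (-((s + 1 : ℕ) : ℤ)) : ℝ) : ℂ) * ω := by
      rw [← Complex.ofReal_mul, ← zpow_add_one₀ hω]
      congr 2
      push_cast
      ring
    rw [truncExp_succ, hpow]
    simp only [Matrix.mulVec_add, Matrix.mulVec_smul, Matrix.mulVec_sum, smul_sub, smul_add,
      Finset.sum_add_distrib, Finset.sum_sub_distrib, Finset.smul_sum, smul_smul]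
    have hcomm : ∀ m : Fin M, ((ω ^ (-((s + 1 : ℕ) : ℤ)) : ℝ) : ℂ) *
          (Complex.exp (Complex.I * (κ m) * ω * t) * (Complex.I * (κ m) * ω)) =
        ((ω ^ (-((s + 1 : ℕ) : ℤ)) : ℝ) : ℂ) * ω *
          (Complex.exp (Complex.I * (κ m) * ω * t) * (Complex.I * (κ m))) := fun m => by ring
    simp only [hcomm]
    abel

end Coefficients

theorem exists_norm_le_on_Icc {E : Type*} [SeminormedAddCommGroup E] {f : ℝ → E}
    (hf : Continuous f) (T : ℝ) : ∃ B, 0 ≤ B ∧ ∀ t ∈ Set.Icc (0 : ℝ) T, ‖f t‖ ≤ B := by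
  obtain ⟨B, hB⟩ := isCompact_Icc.exists_bound_of_continuousOn (s := Set.Icc (0 : ℝ) T)
    hf.continuousOn
  exact ⟨max B 0, le_max_right _ _, fun t ht => (hB t ht).trans (le_max_left _ _)⟩

theorem exists_norm_sum_cexp_smul_le {d M : ℕ} (κ : Fin M → ℝ) {f : Fin M → ℝ → Fin d → ℂ}
    (hf : ∀ m, Continuous (f m)) (T : ℝ) :
    ∃ B, 0 ≤ B ∧ ∀ ω : ℝ, ∀ t ∈ Set.Icc (0 : ℝ) T,
      ‖∑ m : Fin M, Complex.exp (Complex.I * (κ m) * ω * t) • f m t‖ ≤ B := by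
  choose B hB0 hB using fun m => exists_norm_le_on_Icc (hf m) T
  refine ⟨∑ m, B m, Finset.sum_nonneg fun m _ => hB0 m, fun ω t ht => ?_⟩
  refine norm_sum_le_of_le _ fun m _ => ?_
  rw [norm_smul, norm_cexp_I_mul, one_mul]
  exact hB m t ht

/-- Linear Grönwall estimate with zero initial value. -/
theorem exists_norm_le_mul_of_hasDerivAt_mulVec_add {d : ℕ} (A : Matrix (Fin d) (Fin d) ℂ)
    {T : ℝ} (hT : 0 ≤ T) :
    ∃ G, 0 ≤ G ∧ ∀ (z g : ℝ → Fin d → ℂ) (ε : ℝ), 0 ≤ ε → z 0 = 0 →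
      (∀ t ∈ Set.Icc (0 : ℝ) T, HasDerivAt z (A.mulVec (z t) + g t) t) →
      (∀ t ∈ Set.Icc (0 : ℝ) T, ‖g t‖ ≤ ε) → ∀ t ∈ Set.Icc (0 : ℝ) T, ‖z t‖ ≤ G * ε := by
  let L := A.mulVecLin.toContinuousLinearMap
  set K := ‖L‖ + 1 with hK
  have hKpos : 0 < K := by positivity
  refine ⟨(Real.exp (K * T) - 1) / K, div_nonneg (sub_nonneg.mpr
    (Real.one_le_exp (by positivity))) hKpos.le, fun z g ε hε hz0 hz hg t ht => ?_⟩
  have hgr := norm_le_gronwallBound_of_norm_deriv_right_le (f := z) (δ := 0) (K := K) (ε := ε)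
    (fun t ht => (hz t ht).continuousAt.continuousWithinAt)
    (fun t ht => (hz t (Set.Ico_subset_Icc_self ht)).hasDerivWithinAt) (by simp [hz0])
    (fun t ht => ?_) t ht
  · simp only [gronwallBound_of_K_ne_0 hKpos.ne', zero_mul, zero_add, sub_zero] at hgr
    have hexp : Real.exp (K * t) ≤ Real.exp (K * T) :=
      Real.exp_le_exp.mpr (mul_le_mul_of_nonneg_left ht.2 hKpos.le)
    calc ‖z t‖ ≤ ε / K * (Real.exp (K * t) - 1) := hgr
      _ ≤ ε / K * (Real.exp (K * T) - 1) := by gcongr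
      _ = (Real.exp (K * T) - 1) / K * ε := by ring
  · have hA : ‖A.mulVec (z t)‖ ≤ K * ‖z t‖ :=
      (L.le_opNorm (z t)).trans (by gcongr; simp [hK])
    exact (norm_add_le _ _).trans (add_le_add hA (hg t (Set.Ico_subset_Icc_self ht)))

/-- The truncation at level `s` of the asymptotic expansion approximates the solution of
the linear highly oscillatory ODE with uniform error `O(ω^{-s-1})` on `[0, T]`. -/
theorem linear_truncation_error {d M : ℕ} (hd : 1 ≤ d) (hM : 1 ≤ M)
    (A : Matrix (Fin d) (Fin d) ℂ)
    (κ : Fin M → ℝ) (hκ : ∀ m, κ m ≠ 0)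
    (a : Fin M → ℝ → Fin d → ℂ) (ha : ∀ m, ∀ n : ℕ, ContDiff ℝ (n : ℕ∞) (a m))
    (y₀ : Fin d → ℂ)
    (y : ℝ → ℝ → Fin d → ℂ)
    (hy0 : ∀ ω : ℝ, 0 < ω → y ω 0 = y₀)
    (hy : ∀ ω : ℝ, 0 < ω → ∀ t : ℝ, 0 ≤ t →
      HasDerivAt (y ω)
        (A.mulVec (y ω t) +
          ∑ m : Fin M, Complex.exp (Complex.I * (κ m) * ω * t) • a m t) t)
    (T : ℝ) (hT : 0 < T) (s : ℕ) :
    ∃ C > 0, ∀ ω : ℝ, 1 ≤ ω → ∀ t ∈ Set.Icc (0 : ℝ) T,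
      ‖y ω t - truncExp A κ a y₀ s ω t‖ ≤ C * ω ^ (-(s : ℤ) - 1) := by
  obtain ⟨G, hG0, hG⟩ := exists_norm_le_mul_of_hasDerivAt_mulVec_add A hT.le
  obtain ⟨B, hB0, hB⟩ := exists_norm_sum_cexp_smul_le κ (f := fun m t =>
    (Complex.I * (κ m)) • pOsc A κ a (s + 2) m t)
    (fun m => (continuous_pOsc A κ a (ha m) (s + 2)).fun_const_smul _) T
  obtain ⟨P, hP0, hP⟩ := exists_norm_sum_cexp_smul_le κ
    (fun m => continuous_pOsc A κ a (ha m) (s + 1)) T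
  obtain ⟨N, hN0, hN⟩ := exists_norm_le_on_Icc (f := pNonOsc A κ a (s + 1))
    (continuous_iff_continuousAt.mpr fun t => (hasDerivAt_pNonOsc A κ a (s + 1) t).continuousAt) T
  refine ⟨G * B + N + P + 1, by positivity, fun ω hω t ht => ?_⟩
  have hω0 : 0 < ω := by linarith
  set c : ℝ := ω ^ (-((s + 1 : ℕ) : ℤ)) with hc
  have hc0 : 0 < c := by positivity
  have hexp : ω ^ (-(s : ℤ) - 1) = c := by
    rw [hc]
    congr 1
    push_cast
    ring
  have hnorm : ‖(c : ℂ)‖ = c := by rw [Complex.norm_real, Real.norm_of_nonneg hc0.le]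
  have hZ : ‖y ω t - truncExp A κ a y₀ (s + 1) ω t‖ ≤ G * (c * B) := by
    refine hG (fun t => y ω t - truncExp A κ a y₀ (s + 1) ω t)
      (fun t => (c : ℂ) • ∑ m : Fin M, Complex.exp (Complex.I * (κ m) * ω * t) •
          (Complex.I * (κ m)) • pOsc A κ a (s + 2) m t) (c * B) (by positivity)
      (by simp [hy0 ω hω0, truncExp_apply_zero]) (fun t ht => ?_) (fun t ht => ?_) t ht
    · refine ((hy ω hω0 t ht.1).fun_sub
        (hasDerivAt_truncExp A κ a hκ ha y₀ (s + 1) hω0.ne' t)).congr_deriv ?_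
      rw [Matrix.mulVec_sub]
      abel
    · rw [norm_smul, hnorm]
      exact mul_le_mul_of_nonneg_left (hB ω t ht) hc0.le
  have hterm : ‖(c : ℂ) • (pNonOsc A κ a (s + 1) t +
      ∑ m : Fin M, Complex.exp (Complex.I * (κ m) * ω * t) • pOsc A κ a (s + 1) m t)‖ ≤
      c * (N + P) := by
    rw [norm_smul, hnorm]
    exact mul_le_mul_of_nonneg_left ((norm_add_le _ _).trans
      (add_le_add (hN t ht) (hP ω t ht))) hc0.le
  have hsplit := truncExp_succ A κ a y₀ s ω t
  rw [← sub_eq_iff_eq_add] at hsplit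
  rw [hexp, ← hsplit, sub_sub_eq_add_sub, add_sub_right_comm]
  refine (norm_add_le _ _).trans ((add_le_add hZ hterm).trans ?_)
  linarith
end
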